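/- arXiv:2106.02850 — 3 statements merged into one kernel-verified Lean document; each statement's English description precedes it below -/
import Mathlib

section
/- Let ℓ, M be natural numbers and let d : Fin M → Z_{2^ℓ} be a vector that is not identically zero (there exists j with d_j ≠ 0). Then the number of binary combiner vectors τ : Fin M → {0,1} such that Σ_{j} τ_j · d_j = 0 in Z_{2^ℓ} (where τ_j is interpreted as the ring element 0 or 1) is at most 2^{M−1}; equivalently, a uniformly random binary combiner passes the check Σ_j τ_j d_j = 0 with probability at most 1/2. -/
/-- Two binary combiners that annihilate `d` and agree away from an index `j` with `d j ≠ 0`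
are equal. -/
theorem binaryCombiner_eq_of_agree_off {ι G : Type*} [Fintype ι] [DecidableEq ι]
    [AddCommGroup G] {d : ι → G} {j : ι} (hj : d j ≠ 0) {σ τ : ι → Bool}
    (hσ : (∑ i, if σ i then d i else 0) = 0) (hτ : (∑ i, if τ i then d i else 0) = 0)
    (h : ∀ i, i ≠ j → σ i = τ i) : σ = τ := by
  have hsum : (∑ i : {i // i ≠ j}, if σ i then d i else 0) =
      ∑ i : {i // i ≠ j}, if τ i then d i else 0 :=
    Finset.sum_congr rfl fun i _ => by rw [h i i.2]
  rw [Fintype.sum_eq_add_sum_subtype_ne _ j] at hσ hτ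
  rw [hsum] at hσ
  have hterm := add_right_cancel (hσ.trans hτ.symm)
  funext i
  by_cases hi : i = j
  · subst hi
    cases hs : σ i <;> cases ht : τ i <;> simp_all
  · exact h i hi

/-- At most half of the binary combiners annihilate a nonzero vector over an abelian group. -/
theorem card_binaryCombiner_sum_eq_zero_le {ι G : Type*} [Fintype ι] [DecidableEq ι]
    [AddCommGroup G] [DecidableEq G] {d : ι → G} (hd : ∃ j, d j ≠ 0) :
    (Finset.univ.filter
        (fun τ : ι → Bool => (∑ j, if τ j then d j else 0) = 0)).card
      ≤ 2 ^ (Fintype.card ι - 1) := by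
  obtain ⟨j, hj⟩ := hd
  have hcard : (Finset.univ : Finset ({i // i ≠ j} → Bool)).card =
      2 ^ (Fintype.card ι - 1) := by
    simp [Fintype.card_subtype_compl]
  rw [← hcard]
  refine Finset.card_le_card_of_injOn (fun τ i => τ i) (fun _ _ => Finset.mem_univ _) ?_
  intro σ hσ τ hτ h
  simp only [Finset.coe_filter, Finset.mem_univ, true_and, Set.mem_ofPred_eq] at hσ hτ
  exact binaryCombiner_eq_of_agree_off hj hσ hτ fun i hi => congrFun h ⟨i, hi⟩

theorem stmt_6 (ℓ M : ℕ) (d : Fin M → ZMod (2 ^ ℓ)) (hd : ∃ j, d j ≠ 0) :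
    (Finset.univ.filter
        (fun τ : Fin M → Bool => (∑ j, if τ j then d j else 0) = 0)).card
      ≤ 2 ^ (M - 1) := by
  simpa only [Fintype.card_fin] using card_binaryCombiner_sum_eq_zero_le hd
end

section
/- Let ℓ, M, κ be natural numbers and let d : Fin M → Z_{2^ℓ} be a vector that is not identically zero. Then the number of κ-tuples of binary combiner vectors (τ^{(1)}, …, τ^{(κ)}), each τ^{(k)} : Fin M → {0,1}, such that Σ_j τ^{(k)}_j · d_j = 0 in Z_{2^ℓ} for every k ∈ {1,…,κ}, is at most 2^{κ(M−1)}; equivalently, κ independent uniformly random binary-combiner checks all pass with probability at most 2^{−κ}. -/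
/-- A binary combiner annihilating `d` is determined by its values away from an index where `d`
is nonzero. -/
lemma injOn_restrict_ne_of_sum_ite_eq_zero {ι A : Type*} [Fintype ι] [DecidableEq ι]
    [AddCommGroup A] (d : ι → A) {i : ι} (hi : d i ≠ 0) :
    Set.InjOn (fun (t : ι → Bool) (j : {j // j ≠ i}) => t j)
      {t | (∑ j, if t j then d j else 0) = 0} := by
  intro s hs t ht h
  have hne : ∀ j, j ≠ i → s j = t j := fun j hj => congrFun h ⟨j, hj⟩
  simp only [Set.mem_ofPred_eq] at hs ht
  rw [Fintype.sum_eq_add_sum_compl i] at hs ht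
  have hsum : (∑ j ∈ {i}ᶜ, if s j then d j else 0) = ∑ j ∈ {i}ᶜ, if t j then d j else 0 :=
    Finset.sum_congr rfl fun j hj => by rw [hne j (by simpa using hj)]
  rw [hsum] at hs
  have hval := add_right_cancel (hs.trans ht.symm)
  funext j
  by_cases hj : j = i
  · subst hj
    cases hsj : s j <;> cases htj : t j <;> simp_all
  · exact hne j hj

lemma card_filter_sum_ite_eq_zero_le {ι A : Type*} [Fintype ι] [DecidableEq ι]
    [AddCommGroup A] [DecidableEq A] (d : ι → A) (hd : ∃ i, d i ≠ 0) :
    (Finset.univ.filter fun t : ι → Bool => (∑ j, if t j then d j else 0) = 0).card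
      ≤ 2 ^ (Fintype.card ι - 1) := by
  obtain ⟨i, hi⟩ := hd
  have h := Finset.card_le_card_of_injOn
    (s := Finset.univ.filter fun t : ι → Bool => (∑ j, if t j then d j else 0) = 0)
    (t := Finset.univ) (fun (t : ι → Bool) (j : {j // j ≠ i}) => t j) (by simp)
    (by simpa using injOn_restrict_ne_of_sum_ite_eq_zero d hi)
  simpa [Fintype.card_subtype_compl] using h

theorem stmt_7 (ℓ M κ : ℕ) (d : Fin M → ZMod (2 ^ ℓ)) (hd : ∃ j, d j ≠ 0) :
    (Finset.univ.filter
        (fun τ : Fin κ → Fin M → Bool =>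
          ∀ k, (∑ j, if τ k j then d j else 0) = 0)).card
      ≤ 2 ^ (κ * (M - 1)) := by
  have hpi : (Finset.univ.filter (fun τ : Fin κ → Fin M → Bool =>
        ∀ k, (∑ j, if τ k j then d j else 0) = 0)) =
      Fintype.piFinset fun _ : Fin κ =>
        Finset.univ.filter fun t : Fin M → Bool => (∑ j, if t j then d j else 0) = 0 := by
    ext τ
    simp
  rw [hpi, Fintype.card_piFinset_const, mul_comm, pow_mul]
  gcongr
  simpa using card_filter_sum_ite_eq_zero_le d hd
end

section
/- Let R be a commutative ring, let n be a natural number, and let a, b : Fin n → R be vectors with per-coordinate mask shares λ_{a_i}^1, λ_{a_i}^2, λ_{a_i}^3, λ_{b_i}^1, λ_{b_i}^2, λ_{b_i}^3 ∈ R, masked values m_{a_i} = a_i + (λ_{a_i}^1+λ_{a_i}^2+λ_{a_i}^3) and m_{b_i} = b_i + (λ_{b_i}^1+λ_{b_i}^2+λ_{b_i}^3). Define Γ^1 = Σ_i (λ_{a_i}^1 λ_{b_i}^3 + λ_{a_i}^3 λ_{b_i}^1 + λ_{a_i}^3 λ_{b_i}^3), Γ^2 = Σ_i (λ_{a_i}^2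 λ_{b_i}^3 + λ_{a_i}^3 λ_{b_i}^2 + λ_{a_i}^2 λ_{b_i}^2), Γ^3 = Σ_i (λ_{a_i}^1 λ_{b_i}^2 + λ_{a_i}^2 λ_{b_i}^1 + λ_{a_i}^1 λ_{b_i}^1), and let u^1, u^2, r ∈ R satisfy u^1 + u^2 = Γ^3 − r. Define y_1 = Σ_i (−λ_{a_i}^1 m_{b_i} − λ_{b_i}^1 m_{a_i}) + Γ^1 + u^1, y_2 = Σ_i (−λ_{a_i}^2 m_{b_i} − λ_{b_i}^2 m_{a_i}) + Γ^2 + u^2, and y_3 = Σ_i (−λ_{a_i}^3 m_{b_i} − λ_{b_i}^3 m_{a_i}). Then (y_1 + y_2 + y_3) + Σ_i m_{a_i}·m_{b_i} = (Σ_i a_i·b_i) − r. -/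
theorem stmt_15 (R : Type*) [CommRing R] (n : ℕ)
    (a b : Fin n → R)
    (la1 la2 la3 lb1 lb2 lb3 : Fin n → R)
    (m_a m_b : Fin n → R)
    (hma : ∀ i, m_a i = a i + (la1 i + la2 i + la3 i))
    (hmb : ∀ i, m_b i = b i + (lb1 i + lb2 i + lb3 i))
    (G1 G2 G3 : R)
    (hG1 : G1 = ∑ i, (la1 i * lb3 i + la3 i * lb1 i + la3 i * lb3 i))
    (hG2 : G2 = ∑ i, (la2 i * lb3 i + la3 i * lb2 i + la2 i * lb2 i))
    (hG3 : G3 = ∑ i, (la1 i * lb2 i + la2 i * lb1 i + la1 i * lb1 i))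
    (u1 u2 r : R) (hu : u1 + u2 = G3 - r)
    (y1 y2 y3 : R)
    (hy1 : y1 = (∑ i, (-(la1 i * m_b i) - lb1 i * m_a i)) + G1 + u1)
    (hy2 : y2 = (∑ i, (-(la2 i * m_b i) - lb2 i * m_a i)) + G2 + u2)
    (hy3 : y3 = ∑ i, (-(la3 i * m_b i) - lb3 i * m_a i)) :
    (y1 + y2 + y3) + ∑ i, m_a i * m_b i = (∑ i, a i * b i) - r := by
  have key : (∑ i, (-(la1 i * m_b i) - lb1 i * m_a i)) + (∑ i, (-(la2 i * m_b i) - lb2 i * m_a i))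
      + (∑ i, (-(la3 i * m_b i) - lb3 i * m_a i)) + G1 + G2 + G3 + ∑ i, m_a i * m_b i
      = ∑ i, a i * b i := by
    rw [hG1, hG2, hG3]
    simp only [← Finset.sum_add_distrib]
    refine Finset.sum_congr rfl fun i _ => ?_
    rw [hma, hmb]
    ring
  rw [hy1, hy2, hy3]
  linear_combination key + hu
end
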